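/- Let α₁, α₂ ∈ ℂ[X₁, X₂] be homogeneous polynomials of degree 3 with no common zero in ℂ² ∖ {(0,0)}. Then there exist two linearly independent vectors (c₁, c₂), (c₁′, c₂′) ∈ ℂ² and two non-proportional nonzero vectors (u₁, u₂), (v₁, v₂) ∈ ℂ² such that (u₂X₁ − u₁X₂)² divides c₁α₁ + c₂α₂ and (v₂X₁ − v₁X₂)² divides c₁′α₁ + c₂′α₂. (In other words, the degree-3 pencil spanned by α₁, α₂ contains two independent members having double roots at two distinct points of ℙ¹.) -/

import Mathlib

open MvPolynomial

/-- The binary cubic with the given coefficients. -/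
noncomputable def binaryCubic (a₀ a₁ a₂ a₃ : ℂ) : MvPolynomial (Fin 2) ℂ :=
  C a₀ * X 0 ^ 3 + C a₁ * X 0 ^ 2 * X 1 + C a₂ * X 0 * X 1 ^ 2 + C a₃ * X 1 ^ 3

lemma eval_binaryCubic (a₀ a₁ a₂ a₃ x y : ℂ) :
    eval ![x, y] (binaryCubic a₀ a₁ a₂ a₃) =
      a₀ * x ^ 3 + a₁ * x ^ 2 * y + a₂ * x * y ^ 2 + a₃ * y ^ 3 := by
  simp [binaryCubic]

lemma binaryCubic_linear_combination (c d a₀ a₁ a₂ a₃ b₀ b₁ b₂ b₃ : ℂ) :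
    C c * binaryCubic a₀ a₁ a₂ a₃ + C d * binaryCubic b₀ b₁ b₂ b₃ =
      binaryCubic (c * a₀ + d * b₀) (c * a₁ + d * b₁) (c * a₂ + d * b₂) (c * a₃ + d * b₃) := by
  simp only [binaryCubic, C_add, C_mul]
  ring

lemma MvPolynomial.IsHomogeneous.exists_eq_binaryCubic {p : MvPolynomial (Fin 2) ℂ}
    (hp : p.IsHomogeneous 3) : ∃ a₀ a₁ a₂ a₃ : ℂ, p = binaryCubic a₀ a₁ a₂ a₃ := by
  rw [p.as_sum]
  refine Finset.sum_induction _ (fun q => ∃ a₀ a₁ a₂ a₃ : ℂ, q = binaryCubic a₀ a₁ a₂ a₃) ?_ ?_ ?_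
  · rintro _ _ ⟨a₀, a₁, a₂, a₃, rfl⟩ ⟨b₀, b₁, b₂, b₃, rfl⟩
    refine ⟨a₀ + b₀, a₁ + b₁, a₂ + b₂, a₃ + b₃, ?_⟩
    simpa using binaryCubic_linear_combination 1 1 a₀ a₁ a₂ a₃ b₀ b₁ b₂ b₃
  · exact ⟨0, 0, 0, 0, by simp [binaryCubic]⟩
  · intro m hm
    have hdeg : m 0 + m 1 = 3 := by
      have h := hp (mem_support_iff.mp hm)
      simpa [Finsupp.weight_apply, Finsupp.sum_fintype] using h
    have hmon : monomial m (coeff m p) = C (coeff m p) * X 0 ^ m 0 * X 1 ^ m 1 := by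
      rw [monomial_eq, Finsupp.prod_fintype _ _ (by simp), Fin.prod_univ_two, mul_assoc]
    rw [hmon]
    obtain ⟨h0, h1⟩ | ⟨h0, h1⟩ | ⟨h0, h1⟩ | ⟨h0, h1⟩ :
        (m 0 = 3 ∧ m 1 = 0) ∨ (m 0 = 2 ∧ m 1 = 1) ∨ (m 0 = 1 ∧ m 1 = 2) ∨
          (m 0 = 0 ∧ m 1 = 3) := by omega
    · exact ⟨coeff m p, 0, 0, 0, by simp [binaryCubic, h0, h1]⟩
    · exact ⟨0, coeff m p, 0, 0, by simp [binaryCubic, h0, h1]⟩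
    · exact ⟨0, 0, coeff m p, 0, by simp [binaryCubic, h0, h1]⟩
    · exact ⟨0, 0, 0, coeff m p, by simp [binaryCubic, h0, h1]⟩

lemma exists_cubic_root {a₀ a₁ a₂ a₃ : ℂ} (h : a₀ ≠ 0 ∨ a₁ ≠ 0 ∨ a₂ ≠ 0) :
    ∃ t : ℂ, a₀ * t ^ 3 + a₁ * t ^ 2 + a₂ * t + a₃ = 0 := by
  let p : Polynomial ℂ := .C a₀ * .X ^ 3 + .C a₁ * .X ^ 2 + .C a₂ * .X + .C a₃
  have hp : p.degree ≠ 0 := by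
    intro hdeg
    have hc := Polynomial.eq_C_of_degree_eq_zero hdeg
    have h0 := congrArg (Polynomial.coeff · 3) hc
    have h1 := congrArg (Polynomial.coeff · 2) hc
    have h2 := congrArg (Polynomial.coeff · 1) hc
    simp [p, Polynomial.coeff_X, Polynomial.coeff_C] at h0 h1 h2
    simp_all
  obtain ⟨t, ht⟩ := IsAlgClosed.exists_root p hp
  exact ⟨t, by simpa [p] using ht⟩

lemma exists_binaryCubic_zero (a₀ a₁ a₂ a₃ : ℂ) :
    ∃ x : Fin 2 → ℂ, x ≠ 0 ∧ eval x (binaryCubic a₀ a₁ a₂ a₃) = 0 := by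
  by_cases h : a₀ = 0
  · exact ⟨![1, 0], by simp, by simp [eval_binaryCubic, h]⟩
  · obtain ⟨t, ht⟩ := exists_cubic_root (a₁ := a₁) (a₂ := a₂) (a₃ := a₃) (Or.inl h)
    exact ⟨![t, 1], by simp, by simpa [eval_binaryCubic] using ht⟩

/-- A complex quartic has two distinct roots unless it is the fourth power of a linear form. -/
lemma quartic_two_roots_or_fourth_power {e₀ : ℂ} (e₁ e₂ e₃ e₄ : ℂ) (h : e₀ ≠ 0) :
    (∃ r s : ℂ, r ≠ s ∧ e₀ * r ^ 4 + e₁ * r ^ 3 + e₂ * r ^ 2 + e₃ * r + e₄ = 0 ∧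
      e₀ * s ^ 4 + e₁ * s ^ 3 + e₂ * s ^ 2 + e₃ * s + e₄ = 0) ∨
    ∃ r : ℂ, e₁ = -4 * r * e₀ ∧ e₂ = 6 * r ^ 2 * e₀ ∧ e₃ = -4 * r ^ 3 * e₀ ∧ e₄ = r ^ 4 * e₀ := by
  let p : Polynomial ℂ := .C e₀ * .X ^ 4 + .C e₁ * .X ^ 3 + .C e₂ * .X ^ 2 + .C e₃ * .X + .C e₄
  have hdeg : p.natDegree = 4 := by simp only [p]; compute_degree!
  have hlead : p.leadingCoeff = e₀ := by
    rw [Polynomial.leadingCoeff, hdeg]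
    simp [p]
  have hp : p ≠ 0 := by
    intro h0
    simp [h0] at hdeg
  have hs : p.Splits := IsAlgClosed.splits p
  have hcard : p.roots.card = 4 := by rw [← hs.natDegree_eq_card_roots, hdeg]
  have heval (t : ℂ) : p.eval t = e₀ * t ^ 4 + e₁ * t ^ 3 + e₂ * t ^ 2 + e₃ * t + e₄ := by
    simp [p]
  obtain ⟨r, hr⟩ := Multiset.card_pos_iff_exists_mem.mp (by omega : 0 < p.roots.card)
  by_cases hall : ∀ s ∈ p.roots, s = r
  · right
    have hrep : p.roots = Multiset.replicate 4 r := Multiset.eq_replicate.mpr ⟨hcard, hall⟩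
    have hprod := hs.eq_prod_roots
    rw [hlead, hrep] at hprod
    have hpt (t : ℂ) : e₀ * t ^ 4 + e₁ * t ^ 3 + e₂ * t ^ 2 + e₃ * t + e₄ =
        e₀ * (t - r) ^ 4 := by
      rw [← heval, hprod, Multiset.map_replicate, Multiset.prod_replicate]
      simp
    have k0 := hpt 0
    have k1 := hpt 1
    have k2 := hpt (-1)
    have k3 := hpt 2
    have k4 := hpt (-2)
    refine ⟨r, ?_, ?_, ?_, ?_⟩
    · linear_combination (k3 - k4) / 12 - (k1 - k2) / 6
    · linear_combination (k1 + k2) / 2 - k0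
    · linear_combination 2 * (k1 - k2) / 3 - (k3 - k4) / 12
    · linear_combination k0
  · left
    push Not at hall
    obtain ⟨s, hs, hne⟩ := hall
    exact ⟨s, r, hne, by rw [← heval]; exact (Polynomial.mem_roots hp).mp hs,
      by rw [← heval]; exact (Polynomial.mem_roots hp).mp hr⟩

/-- A binary cubic whose partial derivatives vanish at `(u₁, u₂)` has a double root there. -/
lemma sq_dvd_binaryCubic {g₀ g₁ g₂ g₃ u₁ u₂ : ℂ} (hu : u₁ ≠ 0 ∨ u₂ ≠ 0)
    (hx : 3 * g₀ * u₁ ^ 2 + 2 * g₁ * u₁ * u₂ + g₂ * u₂ ^ 2 = 0)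
    (hy : g₁ * u₁ ^ 2 + 2 * g₂ * u₁ * u₂ + 3 * g₃ * u₂ ^ 2 = 0) :
    (C u₂ * X 0 - C u₁ * X 1) ^ 2 ∣ binaryCubic g₀ g₁ g₂ g₃ := by
  by_cases h : u₂ = 0
  · subst h
    have h1 : u₁ ≠ 0 := by simpa using hu
    have hg₀ : g₀ = 0 := by simpa [h1] using hx
    have hg₁ : g₁ = 0 := by simpa [h1] using hy
    refine ⟨C (g₂ / u₁ ^ 2) * X 0 + C (g₃ / u₁ ^ 2) * X 1, ?_⟩
    have e (g : ℂ) : (C g : MvPolynomial (Fin 2) ℂ) = C u₁ ^ 2 * C (g / u₁ ^ 2) := by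
      rw [← C_pow, ← C_mul]; congr 1; field_simp
    rw [binaryCubic, hg₀, hg₁, e g₂, e g₃]
    simp only [C_0]
    ring
  · obtain ⟨r, rfl⟩ : ∃ r, u₁ = r * u₂ := ⟨u₁ / u₂, by field_simp⟩
    have hx' : g₂ = -3 * g₀ * r ^ 2 - 2 * g₁ * r := by
      apply mul_right_cancel₀ (pow_ne_zero 2 h); linear_combination hx
    have hy' : 3 * g₃ = -g₁ * r ^ 2 - 2 * g₂ * r := by
      apply mul_right_cancel₀ (pow_ne_zero 2 h); linear_combination hy
    obtain ⟨A, hA⟩ : ∃ A, g₀ = u₂ ^ 2 * A := ⟨g₀ / u₂ ^ 2, by field_simp⟩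
    obtain ⟨B, hB⟩ : ∃ B, g₁ = u₂ ^ 2 * B := ⟨g₁ / u₂ ^ 2, by field_simp⟩
    have h₂ : g₂ = u₂ ^ 2 * (-3 * A * r ^ 2 - 2 * B * r) := by
      rw [hx', hA, hB]; ring
    have h₃ : g₃ = u₂ ^ 2 * (2 * A * r ^ 3 + B * r ^ 2) := by
      rw [h₂, hB] at hy'; linear_combination hy' / 3
    refine ⟨C A * X 0 + C (B + 2 * r * A) * X 1, ?_⟩
    rw [binaryCubic, h₃, h₂, hA, hB]
    simp only [C_add, C_mul, C_sub, C_pow, C_neg, map_ofNat]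
    ring

/-- A binary cubic cannot have double roots at two distinct points unless it vanishes. -/
lemma eval_binaryCubic_eq_zero_of_two_double_roots {g₀ g₁ g₂ g₃ u₁ u₂ v₁ v₂ : ℂ}
    (hD : u₁ * v₂ - u₂ * v₁ ≠ 0)
    (hux : 3 * g₀ * u₁ ^ 2 + 2 * g₁ * u₁ * u₂ + g₂ * u₂ ^ 2 = 0)
    (huy : g₁ * u₁ ^ 2 + 2 * g₂ * u₁ * u₂ + 3 * g₃ * u₂ ^ 2 = 0)
    (hvx : 3 * g₀ * v₁ ^ 2 + 2 * g₁ * v₁ * v₂ + g₂ * v₂ ^ 2 = 0)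
    (hvy : g₁ * v₁ ^ 2 + 2 * g₂ * v₁ * v₂ + 3 * g₃ * v₂ ^ 2 = 0) (x : Fin 2 → ℂ) :
    eval x (binaryCubic g₀ g₁ g₂ g₃) = 0 := by
  obtain ⟨x, y, rfl⟩ : ∃ y z, x = ![y, z] := ⟨x 0, x 1, by ext i; fin_cases i <;> rfl⟩
  rw [eval_binaryCubic]
  apply (mul_eq_zero.mp _).resolve_left (pow_ne_zero 3 hD)
  obtain ⟨s, hs⟩ : ∃ s, s = x * v₂ - y * v₁ := ⟨_, rfl⟩
  obtain ⟨t, ht⟩ : ∃ t, t = y * u₁ - x * u₂ := ⟨_, rfl⟩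
  have ex : (u₁ * v₂ - u₂ * v₁) * x = s * u₁ + t * v₁ := by rw [hs, ht]; ring
  have ey : (u₁ * v₂ - u₂ * v₁) * y = s * u₂ + t * v₂ := by rw [hs, ht]; ring
  calc _ = g₀ * ((u₁ * v₂ - u₂ * v₁) * x) ^ 3
        + g₁ * ((u₁ * v₂ - u₂ * v₁) * x) ^ 2 * ((u₁ * v₂ - u₂ * v₁) * y)
        + g₂ * ((u₁ * v₂ - u₂ * v₁) * x) * ((u₁ * v₂ - u₂ * v₁) * y) ^ 2
        + g₃ * ((u₁ * v₂ - u₂ * v₁) * y) ^ 3 := by ring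
    _ = 0 := by
      rw [ex, ey]
      linear_combination (s ^ 3 * u₁ / 3 + s ^ 2 * t * v₁) * hux
        + (s ^ 3 * u₂ / 3 + s ^ 2 * t * v₂) * huy
        + (t ^ 3 * v₁ / 3 + s * t ^ 2 * u₁) * hvx + (t ^ 3 * v₂ / 3 + s * t ^ 2 * u₂) * hvy

/-- The Jacobian determinant of a pair of binary cubics, divided by `3`. -/
def cubicJacobian (a₀ a₁ a₂ a₃ b₀ b₁ b₂ b₃ x y : ℂ) : ℂ :=
  (a₀ * b₁ - a₁ * b₀) * x ^ 4 + 2 * (a₀ * b₂ - a₂ * b₀) * x ^ 3 * y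
    + (3 * (a₀ * b₃ - a₃ * b₀) + (a₁ * b₂ - a₂ * b₁)) * x ^ 2 * y ^ 2
    + 2 * (a₁ * b₃ - a₃ * b₁) * x * y ^ 3 + (a₂ * b₃ - a₃ * b₂) * y ^ 4

/-- The Jacobian of two binary cubics without common zero has two non-proportional zeros. -/
lemma exists_two_zeros_cubicJacobian (a₀ a₁ a₂ a₃ b₀ b₁ b₂ b₃ : ℂ)
    (hcz : ∀ x : Fin 2 → ℂ, x ≠ 0 → ¬(eval x (binaryCubic a₀ a₁ a₂ a₃) = 0 ∧
      eval x (binaryCubic b₀ b₁ b₂ b₃) = 0)) :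
    ∃ u₁ u₂ v₁ v₂ : ℂ, u₁ * v₂ - u₂ * v₁ ≠ 0 ∧
      cubicJacobian a₀ a₁ a₂ a₃ b₀ b₁ b₂ b₃ u₁ u₂ = 0 ∧
      cubicJacobian a₀ a₁ a₂ a₃ b₀ b₁ b₂ b₃ v₁ v₂ = 0 := by
  by_cases h01 : a₀ * b₁ - a₁ * b₀ = 0
  · by_cases h : 2 * (a₀ * b₂ - a₂ * b₀) ≠ 0 ∨
        3 * (a₀ * b₃ - a₃ * b₀) + (a₁ * b₂ - a₂ * b₁) ≠ 0 ∨ 2 * (a₁ * b₃ - a₃ * b₁) ≠ 0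
    · obtain ⟨t, ht⟩ := exists_cubic_root (a₃ := a₂ * b₃ - a₃ * b₂) h
      refine ⟨1, 0, t, 1, by simp, by simp [cubicJacobian, h01], ?_⟩
      rw [cubicJacobian]
      linear_combination t ^ 4 * h01 + ht
    · push Not at h
      obtain ⟨h02, h03, h13⟩ := h
      by_cases h23 : a₂ * b₃ - a₃ * b₂ = 0
      · exact ⟨1, 0, 0, 1, by simp, by simp [cubicJacobian, h01], by simp [cubicJacobian, h23]⟩
      · exfalso
        have hsq : (a₀ * b₃ - a₃ * b₀) ^ 2 = 0 := by
          linear_combination (a₀ * b₃ - a₃ * b₀) * h03 / 3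
            + (a₂ * b₃ - a₃ * b₂) * h01 / 3 - (a₁ * b₃ - a₃ * b₁) * h02 / 6
        have h03' := pow_eq_zero_iff two_ne_zero |>.mp hsq
        have ha : a₀ = 0 := by
          apply (mul_eq_zero.mp _).resolve_left h23
          linear_combination a₂ * h03' - a₃ * h02 / 2
        have hb : b₀ = 0 := by
          apply (mul_eq_zero.mp _).resolve_left h23
          linear_combination b₂ * h03' - b₃ * h02 / 2
        exact hcz ![1, 0] (by simp) (by simp [eval_binaryCubic, ha, hb])
  · obtain ⟨r, s, hne, hr, hs⟩ | ⟨r, h02, h03, h13, h23⟩ := quartic_two_roots_or_fourth_power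
      (2 * (a₀ * b₂ - a₂ * b₀)) (3 * (a₀ * b₃ - a₃ * b₀) + (a₁ * b₂ - a₂ * b₁))
      (2 * (a₁ * b₃ - a₃ * b₁)) (a₂ * b₃ - a₃ * b₂) h01
    · refine ⟨r, 1, s, 1, by simpa [sub_eq_zero] using hne, ?_, ?_⟩ <;> rw [cubicJacobian]
      · linear_combination hr
      · linear_combination hs
    · exfalso
      have h02' : a₀ * b₂ - a₂ * b₀ = -2 * r * (a₀ * b₁ - a₁ * b₀) := by
        linear_combination h02 / 2
      have h13' : a₁ * b₃ - a₃ * b₁ = -2 * r ^ 3 * (a₀ * b₁ - a₁ * b₀) := by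
        linear_combination h13 / 2
      have hsq : (a₀ * b₃ - a₃ * b₀ - r ^ 2 * (a₀ * b₁ - a₁ * b₀)) ^ 2 = 0 := by
        linear_combination (a₀ * b₃ - a₃ * b₀) * h03 / 3
          + (a₀ * b₁ - a₁ * b₀) * h23 / 3 - (a₁ * b₃ - a₃ * b₁) * h02' / 3
          + 2 * r * (a₀ * b₁ - a₁ * b₀) * h13' / 3
      have h03' := pow_eq_zero_iff two_ne_zero |>.mp hsq
      have ha : a₀ * r ^ 3 + a₁ * r ^ 2 + a₂ * r + a₃ = 0 := by
        apply (mul_eq_zero.mp _).resolve_left h01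
        linear_combination r * a₁ * h02' - r * a₀ * (h03 - 3 * h03') + a₁ * h03' - a₀ * h13'
      have hb : b₀ * r ^ 3 + b₁ * r ^ 2 + b₂ * r + b₃ = 0 := by
        apply (mul_eq_zero.mp _).resolve_left h01
        linear_combination r * b₁ * h02' - r * b₀ * (h03 - 3 * h03') + b₁ * h03' - b₀ * h13'
      exact hcz ![r, 1] (by simp) (by simp [eval_binaryCubic, ha, hb])

lemma exists_nontrivial_relation {p q p' q' : ℂ} (h : p * q' - q * p' = 0) :
    ∃ c d : ℂ, (c ≠ 0 ∨ d ≠ 0) ∧ c * p + d * p' = 0 ∧ c * q + d * q' = 0 := by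
  by_cases hp : p = 0 ∧ p' = 0
  · by_cases hq : q = 0 ∧ q' = 0
    · exact ⟨1, 0, by simp, by simp [hp], by simp [hq]⟩
    · exact ⟨q', -q, by grind, by simp [hp], by ring⟩
  · exact ⟨p', -p, by grind, by ring, by linear_combination -h⟩

/-- At a zero of the Jacobian, some nontrivial member of the pencil is singular. -/
lemma exists_singular_member {a₀ a₁ a₂ a₃ b₀ b₁ b₂ b₃ x y : ℂ}
    (h : cubicJacobian a₀ a₁ a₂ a₃ b₀ b₁ b₂ b₃ x y = 0) :
    ∃ c d : ℂ, (c ≠ 0 ∨ d ≠ 0) ∧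
      3 * (c * a₀ + d * b₀) * x ^ 2 + 2 * (c * a₁ + d * b₁) * x * y
        + (c * a₂ + d * b₂) * y ^ 2 = 0 ∧
      (c * a₁ + d * b₁) * x ^ 2 + 2 * (c * a₂ + d * b₂) * x * y
        + 3 * (c * a₃ + d * b₃) * y ^ 2 = 0 := by
  obtain ⟨c, d, hcd, hx, hy⟩ := exists_nontrivial_relation
    (p := 3 * a₀ * x ^ 2 + 2 * a₁ * x * y + a₂ * y ^ 2)
    (q := a₁ * x ^ 2 + 2 * a₂ * x * y + 3 * a₃ * y ^ 2)
    (p' := 3 * b₀ * x ^ 2 + 2 * b₁ * x * y + b₂ * y ^ 2)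
    (q' := b₁ * x ^ 2 + 2 * b₂ * x * y + 3 * b₃ * y ^ 2)
    (by rw [cubicJacobian] at h; linear_combination 3 * h)
  exact ⟨c, d, hcd, by linear_combination hx, by linear_combination hy⟩

lemma linearIndependent_pair_of_det_ne_zero {c d c' d' : ℂ} (h : c * d' - d * c' ≠ 0) :
    LinearIndependent ℂ ![(c, d), (c', d')] := by
  rw [LinearIndependent.pair_iff]
  intro s t hst
  simp only [Prod.smul_mk, Prod.mk_add_mk, Prod.mk_eq_zero, smul_eq_mul] at hst
  obtain ⟨h1, h2⟩ := hst
  constructor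
  · apply (mul_eq_zero.mp _).resolve_left h
    linear_combination d' * h1 - c' * h2
  · apply (mul_eq_zero.mp _).resolve_left h
    linear_combination c * h2 - d * h1

/-- Let `α₁, α₂` be binary cubics (in `ℂ[X₁, X₂]`, with `X₁ = X 0, X₂ = X 1`) with no
common zero in `ℂ² ∖ {0}`.  Then the pencil spanned by `α₁, α₂` contains two linearly
independent members having double roots at two distinct points of `ℙ¹`: there are
linearly independent `(c₁, c₂), (c₁′, c₂′) ∈ ℂ²` and non-proportional nonzero
`(u₁, u₂), (v₁, v₂) ∈ ℂ²` with `(u₂X₁ − u₁X₂)² ∣ c₁α₁ + c₂α₂` and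
`(v₂X₁ − v₁X₂)² ∣ c₁′α₁ + c₂′α₂`. -/
theorem pencil_has_two_double_roots (α₁ α₂ : MvPolynomial (Fin 2) ℂ)
    (h₁ : α₁.IsHomogeneous 3) (h₂ : α₂.IsHomogeneous 3)
    (hcz : ∀ x : Fin 2 → ℂ, x ≠ 0 → ¬(eval x α₁ = 0 ∧ eval x α₂ = 0)) :
    ∃ c₁ c₂ c₁' c₂' u₁ u₂ v₁ v₂ : ℂ,
      LinearIndependent ℂ ![(c₁, c₂), (c₁', c₂')] ∧
      LinearIndependent ℂ ![(u₁, u₂), (v₁, v₂)] ∧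
      (C u₂ * X 0 - C u₁ * X 1) ^ 2 ∣ C c₁ * α₁ + C c₂ * α₂ ∧
      (C v₂ * X 0 - C v₁ * X 1) ^ 2 ∣ C c₁' * α₁ + C c₂' * α₂ := by
  obtain ⟨a₀, a₁, a₂, a₃, rfl⟩ := h₁.exists_eq_binaryCubic
  obtain ⟨b₀, b₁, b₂, b₃, rfl⟩ := h₂.exists_eq_binaryCubic
  obtain ⟨u₁, u₂, v₁, v₂, hD, hu, hv⟩ := exists_two_zeros_cubicJacobian _ _ _ _ _ _ _ _ hcz
  obtain ⟨c, d, hcd, hux, huy⟩ := exists_singular_member hu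
  obtain ⟨c', d', hcd', hvx, hvy⟩ := exists_singular_member hv
  refine ⟨c, d, c', d', u₁, u₂, v₁, v₂, linearIndependent_pair_of_det_ne_zero ?_,
    linearIndependent_pair_of_det_ne_zero hD, ?_, ?_⟩
  · intro hdet
    obtain ⟨k, hc, hd⟩ : ∃ k, c = k * c' ∧ d = k * d' := by
      rcases hcd' with h | h
      · exact ⟨c / c', by field_simp, by field_simp; linear_combination -hdet⟩
      · exact ⟨d / d', by field_simp; linear_combination hdet, by field_simp⟩
    have hzero (x : Fin 2 → ℂ) : c * eval x (binaryCubic a₀ a₁ a₂ a₃)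
        + d * eval x (binaryCubic b₀ b₁ b₂ b₃) = 0 := by
      have h := eval_binaryCubic_eq_zero_of_two_double_roots hD hux huy
        (by rw [hc, hd]; linear_combination k * hvx) (by rw [hc, hd]; linear_combination k * hvy) x
      rw [← binaryCubic_linear_combination] at h
      simpa using h
    rcases hcd with h | h
    · obtain ⟨x, hx, h0⟩ := exists_binaryCubic_zero b₀ b₁ b₂ b₃
      exact hcz x hx ⟨by simpa [h0, h] using hzero x, h0⟩
    · obtain ⟨x, hx, h0⟩ := exists_binaryCubic_zero a₀ a₁ a₂ a₃
      exact hcz x hx ⟨h0, by simpa [h0, h] using hzero x⟩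
  · rw [binaryCubic_linear_combination]
    exact sq_dvd_binaryCubic (by by_contra! h; simp [h] at hD) hux huy
  · rw [binaryCubic_linear_combination]
    exact sq_dvd_binaryCubic (by by_contra! h; simp [h] at hD) hvx hvy
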